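/- arXiv:2407.17712 — 13 statements merged into one kernel-verified Lean document; each statement's English description precedes it below -/
import Mathlib

section
/- Let b ≥ 2 be an integer, let λ ∈ (1/b, 1) be a real number, let x ≥ 1 and y ≥ 1 be integers, and set k = ⌊λb⌋ and ℓ = ⌈b/λ⌉. For 1 ≤ i ≤ k let q_i = ((b−1)/b)^{k−i} / (b(1 − (1 − 1/b)^k)), and for 1 ≤ i ≤ ℓ let r_i = ((b−1)/b)^{ℓ−i} / (b(1 − (1 − 1/b)^ℓ)). Define the expected algorithm cost E = Σ_{i=1}^{k} c_i q_i if y ≥ b, and E = Σ_{i=1}^{ℓ} c_i r_i if y < b, where c_i = b + i − 1 when i ≤ x and c_i = x when i > x. Let OPT = min(b, x) and η = |y − x|. Then E ≤ min{ ((1 + 1/b)/(1 − e^{−(λ − 1/b)})) · OPT , (λ/(1 − e^{−λ})) · (OPT + η) }. -/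
/-- The expected cost, before normalization, telescopes to `b * min m x`. -/
theorem sum_cost_mul_pow (b x : ℕ) (hb : 2 ≤ b) (m : ℕ) :
    ∑ i ∈ Finset.Icc 1 m, (if i ≤ x then (b : ℝ) + i - 1 else (x : ℝ)) *
      ((b - 1 : ℝ) / b) ^ (m - i) = b * (min m x : ℕ) := by
  have hb0 : (b : ℝ) ≠ 0 := by positivity
  induction m with
  | zero => simp
  | succ m ih =>
    have hstep : ∑ i ∈ Finset.Icc 1 m, (if i ≤ x then (b : ℝ) + i - 1 else (x : ℝ)) *
        ((b - 1 : ℝ) / b) ^ (m + 1 - i) = ((b - 1 : ℝ) / b) * (b * (min m x : ℕ)) := by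
      rw [← ih, Finset.mul_sum]
      refine Finset.sum_congr rfl fun i hi => ?_
      rw [Nat.succ_sub (Finset.mem_Icc.mp hi).2, pow_succ]
      ring
    rw [Finset.sum_Icc_succ_top (by omega), hstep, Nat.sub_self, pow_zero, mul_one,
      ← mul_assoc, div_mul_cancel₀ _ hb0]
    split_ifs with h
    · rw [min_eq_left (by omega : m ≤ x), min_eq_left h]
      push_cast
      ring
    · rw [min_eq_right (by omega : x ≤ m), min_eq_right (by omega : x ≤ m + 1)]
      ring

theorem expected_cost_eq (b x : ℕ) (hb : 2 ≤ b) (m : ℕ) :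
    ∑ i ∈ Finset.Icc 1 m, (if i ≤ x then (b : ℝ) + i - 1 else (x : ℝ)) *
      (((b - 1 : ℝ) / b) ^ (m - i) / (b * (1 - (1 - 1 / (b : ℝ)) ^ m))) =
      (min m x : ℕ) / (1 - (1 - 1 / (b : ℝ)) ^ m) := by
  have hb0 : (b : ℝ) ≠ 0 := by positivity
  simp_rw [← mul_div_assoc]
  rw [← Finset.sum_div, sum_cost_mul_pow b x hb m, mul_div_mul_left _ _ hb0]

theorem one_sub_inv_pow_le_exp (b : ℕ) (hb : 2 ≤ b) (m : ℕ) {t : ℝ} (ht : t ≤ m / b) :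
    (1 - 1 / (b : ℝ)) ^ m ≤ Real.exp (-t) := by
  have hb1 : 1 / (b : ℝ) ≤ 1 := by
    rw [div_le_one (by positivity)]
    exact_mod_cast (by omega : 1 ≤ b)
  calc (1 - 1 / (b : ℝ)) ^ m ≤ Real.exp (-(1 / (b : ℝ))) ^ m :=
        pow_le_pow_left₀ (by linarith) (by linarith [Real.add_one_le_exp (-(1 / (b : ℝ)))]) m
    _ = Real.exp (-(m / b)) := by
        rw [← Real.exp_nat_mul]
        ring_nf
    _ ≤ Real.exp (-t) := Real.exp_le_exp.mpr (by linarith)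

theorem one_sub_exp_neg_pos {t : ℝ} (ht : 0 < t) : 0 < 1 - Real.exp (-t) := by
  have := Real.exp_lt_one_iff.mpr (neg_lt_zero.mpr ht)
  linarith

/-- The function `t / (1 - exp (-t))` is monotone on the positive reals. -/
theorem div_one_sub_exp_neg_mono {s t : ℝ} (hs : 0 < s) (hst : s ≤ t) :
    s / (1 - Real.exp (-s)) ≤ t / (1 - Real.exp (-t)) := by
  have ht : 0 < t := hs.trans_le hst
  rw [div_le_div_iff₀ (one_sub_exp_neg_pos hs) (one_sub_exp_neg_pos ht)]
  have hle : s / t ≤ 1 := (div_le_one ht).mpr hst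
  have h := convexOn_exp.2 (Set.mem_univ 0) (Set.mem_univ (-t))
    (sub_nonneg.mpr hle) (by positivity : 0 ≤ s / t) (by ring)
  simp only [smul_eq_mul, mul_zero, zero_add, Real.exp_zero, mul_one] at h
  rw [show s / t * -t = -s by field_simp] at h
  have h' := mul_le_mul_of_nonneg_left h ht.le
  have e : t * (1 - s / t + s / t * Real.exp (-t)) = t - s + s * Real.exp (-t) := by
    field_simp
  rw [e] at h'
  linarith

theorem one_sub_exp_neg_le {l : ℝ} (hl : 0 < l) (hl1 : l ≤ 1) :
    1 - Real.exp (-l) ≤ l * (1 - Real.exp (-(1 / l))) := by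
  rcases le_total l (1 / 2) with h | h
  · have hexp : (1 - l / 4) ^ 4 ≤ Real.exp (-l) := by
      rw [show -l = ((4 : ℕ) : ℝ) * (-(l / 4)) by push_cast; ring, Real.exp_nat_mul]
      exact pow_le_pow_left₀ (by linarith) (by linarith [Real.add_one_le_exp (-(l / 4))]) 4
    have hcubic : 1 + 1 / l + (1 / l) ^ 2 / 2 + (1 / l) ^ 3 / 6 ≤ Real.exp (1 / l) := by
      have := Real.sum_le_exp_of_nonneg (by positivity : 0 ≤ 1 / l) 4
      simpa [Finset.sum_range_succ, Nat.factorial] using this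
    have hinv : Real.exp (-(1 / l)) ≤ 3 * l / 8 - l ^ 2 / 16 := by
      rw [Real.exp_neg]
      refine (inv_anti₀ (by positivity) hcubic).trans ?_
      rw [inv_le_iff_one_le_mul₀ (by positivity)]
      have e : (3 * l / 8 - l ^ 2 / 16) * (1 + 1 / l + (1 / l) ^ 2 / 2 + (1 / l) ^ 3 / 6) =
          (6 - l) * (6 * l ^ 3 + 6 * l ^ 2 + 3 * l + 1) / (96 * l ^ 2) := by
        field_simp
        ring
      rw [e, one_le_div (by positivity)]
      nlinarith [mul_nonneg hl.le (sub_nonneg.mpr h), mul_nonneg (sq_nonneg l) (sub_nonneg.mpr h),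
        mul_nonneg (pow_nonneg hl.le 3) (sub_nonneg.mpr h)]
    nlinarith [mul_le_mul_of_nonneg_left hinv hl.le, pow_nonneg hl.le 4]
  · have he : Real.exp (-l) = Real.exp (-1) * Real.exp (1 - l) := by
      rw [← Real.exp_add]
      ring_nf
    have hquad : 1 + (1 - l) + (1 - l) ^ 2 / 2 ≤ Real.exp (1 - l) :=
      Real.quadratic_le_exp_of_nonneg (by linarith)
    have hinv : Real.exp (-(1 / l)) ≤ Real.exp (-1) * l := by
      have h1 : Real.exp (-(1 / l)) = Real.exp (-1) * (Real.exp (1 / l - 1))⁻¹ := by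
        rw [← Real.exp_neg, ← Real.exp_add]
        ring_nf
      have h2 : 1 / l ≤ Real.exp (1 / l - 1) := by
        linarith [Real.add_one_le_exp (1 / l - 1)]
      rw [h1]
      refine mul_le_mul_of_nonneg_left ?_ (Real.exp_pos _).le
      simpa using inv_anti₀ (by positivity) h2
    have hone : 1 ≤ Real.exp (-1) * (11 / 4) := by
      rw [Real.exp_neg, inv_mul_eq_div, one_le_div (Real.exp_pos 1)]
      linarith [Real.exp_one_lt_d9]
    rw [he]
    have hp := Real.exp_pos (-1)
    nlinarith [mul_le_mul_of_nonneg_left hquad hp.le, mul_le_mul_of_nonneg_left hinv hl.le,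
      mul_le_mul_of_nonneg_left hone (sub_nonneg.mpr hl1),
      mul_nonneg (mul_nonneg hp.le (sub_nonneg.mpr hl1)) (sub_nonneg.mpr h)]

theorem inv_one_sub_exp_neg_inv_le {l : ℝ} (hl : 0 < l) (hl1 : l ≤ 1) :
    1 / (1 - Real.exp (-(1 / l))) ≤ l / (1 - Real.exp (-l)) := by
  rw [div_le_div_iff₀ (one_sub_exp_neg_pos (by positivity)) (one_sub_exp_neg_pos hl), one_mul]
  exact one_sub_exp_neg_le hl hl1

theorem div_one_sub_pow_le (b : ℕ) (hb : 2 ≤ b) (m : ℕ) {s t : ℝ} (hs : 0 ≤ s) (ht : 0 < t)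
    (htm : t ≤ m / b) :
    s / (1 - (1 - 1 / (b : ℝ)) ^ m) ≤ s / (1 - Real.exp (-t)) :=
  div_le_div_of_nonneg_left hs (one_sub_exp_neg_pos ht)
    (sub_le_sub_left (one_sub_inv_pow_le_exp b hb m htm) 1)


theorem ski_randomized_main (b x y : ℕ) (hb : 2 ≤ b) (hx : 1 ≤ x) (hy : 1 ≤ y)
    (l : ℝ) (hl : 1 / (b : ℝ) < l) (hl1 : l < 1) :
    (if b ≤ y then
        ∑ i ∈ Finset.Icc 1 (⌊l * b⌋₊),
          (if i ≤ x then (b : ℝ) + i - 1 else (x : ℝ)) *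
            (((b - 1 : ℝ) / b) ^ (⌊l * b⌋₊ - i) /
              (b * (1 - (1 - 1 / (b : ℝ)) ^ (⌊l * b⌋₊))))
      else
        ∑ i ∈ Finset.Icc 1 (⌈(b : ℝ) / l⌉₊),
          (if i ≤ x then (b : ℝ) + i - 1 else (x : ℝ)) *
            (((b - 1 : ℝ) / b) ^ (⌈(b : ℝ) / l⌉₊ - i) /
              (b * (1 - (1 - 1 / (b : ℝ)) ^ (⌈(b : ℝ) / l⌉₊))))) ≤
      min (((1 + 1 / (b : ℝ)) / (1 - Real.exp (-(l - 1 / (b : ℝ))))) * (min b x : ℕ))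
        ((l / (1 - Real.exp (-l))) * ((min b x : ℕ) + |(y : ℝ) - x|)) := by
  have hb0 : (0 : ℝ) < b := by positivity
  have hl0 : 0 < l := lt_trans (by positivity) hl
  have hlb : 0 < l - 1 / (b : ℝ) := sub_pos.mpr hl
  have hratio : 0 ≤ l / (1 - Real.exp (-l)) := div_nonneg hl0.le (one_sub_exp_neg_pos hl0).le
  have hinvb : 0 ≤ 1 / (b : ℝ) := by positivity
  rw [expected_cost_eq b x hb, expected_cost_eq b x hb]
  split_ifs with hyb
  · set k := ⌊l * b⌋₊
    have hkle : (k : ℝ) ≤ l * b := Nat.floor_le (by positivity)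
    have hklt : l * b < k + 1 := Nat.lt_floor_add_one _
    have hkb : k ≤ b := by
      have : (k : ℝ) ≤ b := by nlinarith
      exact_mod_cast this
    have hkpos : 0 < k := Nat.floor_pos.mpr ((div_le_iff₀ hb0).mp hl.le)
    have hkr : (0 : ℝ) < k := by exact_mod_cast hkpos
    refine le_min ?_ ?_
    · have ht : l - 1 / (b : ℝ) ≤ k / b := by
        rw [le_div_iff₀ hb0, sub_mul, one_div_mul_cancel hb0.ne']
        linarith
      refine (div_one_sub_pow_le b hb k (by positivity) hlb ht).trans ?_
      rw [div_mul_eq_mul_div]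
      refine div_le_div_of_nonneg_right ?_ (one_sub_exp_neg_pos hlb).le
      have h1 : ((min k x : ℕ) : ℝ) ≤ (min b x : ℕ) := by
        exact_mod_cast min_le_min_right x hkb
      nlinarith [(Nat.cast_nonneg (min b x) : (0 : ℝ) ≤ _)]
    · have hopt : (b : ℝ) ≤ (min b x : ℕ) + |(y : ℝ) - x| := by
        rcases le_total b x with h | h
        · rw [min_eq_left h]
          linarith [abs_nonneg ((y : ℝ) - x)]
        · rw [min_eq_right h]
          have : (b : ℝ) ≤ y := by exact_mod_cast hyb
          linarith [le_abs_self ((y : ℝ) - x)]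
      have hmin : ((min k x : ℕ) : ℝ) ≤ k := by exact_mod_cast min_le_left k x
      have hkbpos : 0 < (k : ℝ) / b := by positivity
      calc ((min k x : ℕ) : ℝ) / (1 - (1 - 1 / (b : ℝ)) ^ k)
          ≤ (min k x : ℕ) / (1 - Real.exp (-(k / b))) :=
            div_one_sub_pow_le b hb k (by positivity) hkbpos le_rfl
        _ ≤ k / (1 - Real.exp (-(k / b))) :=
            div_le_div_of_nonneg_right hmin (one_sub_exp_neg_pos hkbpos).le
        _ = (k / b) / (1 - Real.exp (-(k / b))) * b := by
            rw [div_mul_eq_mul_div, div_mul_cancel₀ _ hb0.ne']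
        _ ≤ l / (1 - Real.exp (-l)) * b :=
            mul_le_mul_of_nonneg_right
              (div_one_sub_exp_neg_mono hkbpos ((div_le_iff₀ hb0).mpr hkle)) hb0.le
        _ ≤ _ := mul_le_mul_of_nonneg_left hopt hratio
  · set m := ⌈(b : ℝ) / l⌉₊
    have hmle : (b : ℝ) / l ≤ m := Nat.le_ceil _
    have hmlt : (m : ℝ) < b / l + 1 := Nat.ceil_lt_add_one (by positivity)
    have hil : 1 / l ≤ m / b := by
      rw [le_div_iff₀ hb0, one_div_mul_eq_div]
      exact hmle
    have hil1 : 1 ≤ 1 / l := by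
      rw [le_div_iff₀ hl0]
      linarith
    have hbound : ((min m x : ℕ) : ℝ) / (1 - (1 - 1 / (b : ℝ)) ^ m) ≤
        l / (1 - Real.exp (-l)) * (min m x : ℕ) := by
      refine (div_one_sub_pow_le b hb m (by positivity) (by positivity) hil).trans ?_
      rw [div_eq_mul_one_div, mul_comm]
      exact mul_le_mul_of_nonneg_right (inv_one_sub_exp_neg_inv_le hl0 hl1.le) (by positivity)
    refine le_min ?_ ?_
    · have hopt : l * (min m x : ℕ) ≤ (1 + 1 / (b : ℝ)) * (min b x : ℕ) := by
        rcases le_total b x with h | h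
        · rw [min_eq_left h]
          have h1 : ((min m x : ℕ) : ℝ) ≤ m := by exact_mod_cast min_le_left m x
          have h2 : l * (b / l) = b := mul_div_cancel₀ _ hl0.ne'
          have h3 : (1 + 1 / (b : ℝ)) * b = b + 1 := by field_simp
          nlinarith
        · rw [min_eq_right h]
          have h1 : ((min m x : ℕ) : ℝ) ≤ x := by exact_mod_cast min_le_right m x
          have hx0 : (0 : ℝ) ≤ x := Nat.cast_nonneg x
          nlinarith [mul_nonneg hinvb hx0]
      refine hbound.trans ?_
      rw [div_mul_eq_mul_div, div_mul_eq_mul_div]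
      refine div_le_div₀ (by positivity) hopt (one_sub_exp_neg_pos hlb) ?_
      exact sub_le_sub_left (Real.exp_le_exp.mpr (by linarith)) 1
    · refine hbound.trans (mul_le_mul_of_nonneg_left ?_ hratio)
      have h1 : ((min m x : ℕ) : ℝ) ≤ x := by exact_mod_cast min_le_right m x
      rcases le_total b x with h | h
      · rw [min_eq_left h]
        have : (y : ℝ) ≤ b := by exact_mod_cast (not_le.mp hyb).le
        linarith [neg_abs_le ((y : ℝ) - x)]
      · rw [min_eq_right h]
        linarith [abs_nonneg ((y : ℝ) - x)]
end

section
/- Let b ≥ 1 be an integer, λ ∈ (0, 1) a real number, and x ≥ 1, y ≥ 1 integers. Define ALG = (b + ⌈λb⌉ − 1 if x ≥ ⌈λb⌉, else x) when y ≥ b, and ALG = (b + ⌈b/λ⌉ − 1 if x ≥ ⌈b/λ⌉, else x) when y < b. Then ALG ≤ ((1 + λ)/λ) · min(b, x). -/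
theorem ski_deterministic_robust (b x y : ℕ) (hb : 1 ≤ b) (hx : 1 ≤ x) (hy : 1 ≤ y)
    (l : ℝ) (hl0 : 0 < l) (hl1 : l < 1) :
    (if b ≤ y then
        (if ⌈l * b⌉₊ ≤ x then (b : ℝ) + ⌈l * b⌉₊ - 1 else (x : ℝ))
      else
        (if ⌈(b : ℝ) / l⌉₊ ≤ x then (b : ℝ) + ⌈(b : ℝ) / l⌉₊ - 1 else (x : ℝ))) ≤
      ((1 + l) / l) * (min b x : ℕ) := by
  have ratio_mul (m : ℝ) : (1 + l) / l * m = m + m / l := by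
    field_simp
    ring
  have hb0 : (0 : ℝ) ≤ b := b.cast_nonneg
  have hx0 : (0 : ℝ) ≤ x / l := by positivity
  have hceil_le : ⌈l * b⌉₊ ≤ b := Nat.ceil_le.2 (mul_le_of_le_one_left hb0 hl1.le)
  have hle_div : (b : ℝ) ≤ b / l := le_div_self hb0 hl0 hl1.le
  rw [ratio_mul]
  split_ifs with hby hbuy hbuy
  · have hceil_min : (⌈l * b⌉₊ : ℝ) ≤ (min b x : ℕ) := by
      exact_mod_cast le_min hceil_le hbuy
    have hb_le : (b : ℝ) ≤ (min b x : ℕ) / l := by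
      rw [le_div_iff₀ hl0, mul_comm]
      exact (Nat.le_ceil _).trans hceil_min
    linarith
  · rw [min_eq_right (by omega)]
    linarith
  · have hbx : b ≤ x := by
      exact_mod_cast hle_div.trans (Nat.ceil_le.1 hbuy)
    rw [min_eq_left hbx]
    linarith [Nat.ceil_lt_add_one (hb0.trans hle_div)]
  · rcases le_total b x with hbx | hxb
    · rw [min_eq_left hbx]
      linarith [Nat.lt_ceil.1 (not_le.1 hbuy)]
    · rw [min_eq_right hxb]
      linarith
end

section
/- Let b ≥ 1 be an integer, λ ∈ (0, 1) a real number, and x ≥ 1, y ≥ 1 integers. Define ALG = (b + ⌈λb⌉ − 1 if x ≥ ⌈λb⌉, else x) when y ≥ b, and ALG = (b + ⌈b/λ⌉ − 1 if x ≥ ⌈b/λ⌉, else x) when y < b. Then ALG ≤ (1 + λ) · min(b, x) + |y − x|/(1 − λ). -/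
theorem ski_deterministic_consistent (b x y : ℕ) (hb : 1 ≤ b) (hx : 1 ≤ x) (hy : 1 ≤ y)
    (l : ℝ) (hl0 : 0 < l) (hl1 : l < 1) :
    (if b ≤ y then
        (if ⌈l * b⌉₊ ≤ x then (b : ℝ) + ⌈l * b⌉₊ - 1 else (x : ℝ))
      else
        (if ⌈(b : ℝ) / l⌉₊ ≤ x then (b : ℝ) + ⌈(b : ℝ) / l⌉₊ - 1 else (x : ℝ))) ≤
      (1 + l) * (min b x : ℕ) + |(y : ℝ) - x| / (1 - l) := by
  have hl : 0 < 1 - l := by linarith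
  have hb0 : (0 : ℝ) ≤ b := b.cast_nonneg
  have hx0 : (0 : ℝ) ≤ x := x.cast_nonneg
  have hlb : 0 ≤ l * b := by positivity
  have hlx : 0 ≤ l * x := by positivity
  have herr := abs_nonneg ((y : ℝ) - x)
  have hdiv : (1 + l) * |(y : ℝ) - x| ≤ |(y : ℝ) - x| / (1 - l) := by
    rw [le_div_iff₀ hl]
    nlinarith [mul_nonneg herr (sq_nonneg l)]
  have hlerr := mul_nonneg hl0.le herr
  rcases le_total b x with hbx | hbx
  · have hbx' : (b : ℝ) ≤ x := by exact_mod_cast hbx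
    rw [min_eq_left hbx]
    split_ifs with hyb hc hc
    · linarith [Nat.ceil_lt_add_one hlb]
    · have hcb : ⌈l * (b : ℝ)⌉₊ ≤ b := Nat.ceil_le.2 (by nlinarith)
      omega
    · have hyb' : (y : ℝ) ≤ b := by exact_mod_cast (not_le.1 hyb).le
      have hdx : (b : ℝ) / l ≤ x := Nat.ceil_le.1 hc
      have hd := Nat.ceil_lt_add_one (div_nonneg hb0 hl0.le)
      have hlate : (b : ℝ) / l ≤ |(y : ℝ) - x| / (1 - l) := by
        rw [le_div_iff₀ hl]
        have hmul : (b : ℝ) / l * (1 - l) = b / l - b := by field_simp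
        linarith [neg_abs_le ((y : ℝ) - x)]
      linarith
    · have hyb' : (y : ℝ) ≤ b := by exact_mod_cast (not_le.1 hyb).le
      linarith [neg_abs_le ((y : ℝ) - x)]
  · have hbx' : (x : ℝ) ≤ b := by exact_mod_cast hbx
    rw [min_eq_right hbx]
    split_ifs with hyb hc hc
    · have hyb' : (b : ℝ) ≤ y := by exact_mod_cast hyb
      have hgap : (1 + l) * ((b : ℝ) - x) ≤ (1 + l) * |(y : ℝ) - x| :=
        mul_le_mul_of_nonneg_left (by linarith [le_abs_self ((y : ℝ) - x)]) (by linarith)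
      linarith [Nat.ceil_lt_add_one hlb]
    · linarith
    · have hdx : (b : ℝ) / l ≤ x := Nat.ceil_le.1 hc
      have hb1 : (1 : ℝ) ≤ b := by exact_mod_cast hb
      have hlt : (b : ℝ) < b / l := by
        rw [lt_div_iff₀ hl0]
        nlinarith
      linarith
    · linarith
end

section
/- Let n ≥ 1 and let x_1 ≤ x_2 ≤ ... ≤ x_n be real numbers with x_j ≥ 1 for all j, and let y_1, ..., y_n be real numbers. Let η = Σ_{j=1}^n |x_j − y_j|, OPT = Σ_{j=1}^n (n − j + 1)·x_j, and ALG = Σ_{j=1}^n x_j + Σ_{i<j, y_i<y_j} x_i + Σ_{i<j, y_i≥y_j} x_j. Then ALG ≤ (1 + 2η/n) · OPT. -/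
theorem sum_ite_lt_const {n : ℕ} (j : Fin n) (c : ℝ) :
    ∑ i : Fin n, (if i < j then c else 0) = (j : ℝ) * c := by
  rw [← Finset.sum_filter, Finset.sum_const, nsmul_eq_mul]
  congr 2
  have : Finset.univ.filter (fun i : Fin n => i < j) = Finset.Iio j := by ext; simp
  rw [this, Fin.card_Iio]

theorem sum_ite_gt_const {n : ℕ} (i : Fin n) (c : ℝ) :
    ∑ j : Fin n, (if i < j then c else 0) = ((n : ℝ) - 1 - i) * c := by
  rw [← Finset.sum_filter, Finset.sum_const, nsmul_eq_mul]
  have : Finset.univ.filter (fun j : Fin n => i < j) = Finset.Ioi i := by ext; simp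
  rw [this, Fin.card_Ioi, Nat.sub_sub, Nat.cast_sub (by omega)]
  push_cast
  ring

/-- Summing the left entry over all ordered pairs `i < j`. -/
theorem sum_sum_ite_lt_left {n : ℕ} (f : Fin n → ℝ) :
    ∑ j, ∑ i, (if i < j then f i else 0) = ∑ i, ((n : ℝ) - 1 - i) * f i := by
  rw [Finset.sum_comm]
  exact Finset.sum_congr rfl fun i _ => sum_ite_gt_const i (f i)

/-- Every `f i + f j` summed over the pairs `i < j` counts each entry `n - 1` times. -/
theorem sum_sum_ite_lt_add {n : ℕ} (f : Fin n → ℝ) :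
    ∑ j, ∑ i, (if i < j then f i + f j else 0) = ((n : ℝ) - 1) * ∑ j, f j := by
  have split : ∀ i j : Fin n, (if i < j then f i + f j else 0) =
      (if i < j then f i else 0) + (if i < j then f j else 0) := by
    intro i j
    split_ifs <;> simp
  simp only [split, Finset.sum_add_distrib, sum_sum_ite_lt_left, sum_ite_lt_const]
  rw [← Finset.sum_add_distrib, Finset.mul_sum]
  exact Finset.sum_congr rfl fun j _ => by ring

/-- The optimum is the total length plus the delay caused by the shorter job of each pair. -/
theorem opt_eq_sum_add_delays {n : ℕ} (x : Fin n → ℝ) :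
    ∑ j, ((n : ℝ) - j) * x j = ∑ j, x j + ∑ j, ∑ i, (if i < j then x i else 0) := by
  rw [sum_sum_ite_lt_left, ← Finset.sum_add_distrib]
  exact Finset.sum_congr rfl fun j _ => by ring

theorem opt_lower_bound {n : ℕ} (x : Fin n → ℝ) (hx1 : ∀ j, 1 ≤ x j) :
    (n : ℝ) * (n + 1) / 2 ≤ ∑ j, ((n : ℝ) - j) * x j := by
  have pairs := sum_sum_ite_lt_add (n := n) fun _ => (1 / 2 : ℝ)
  have unit := opt_eq_sum_add_delays (n := n) fun _ => (1 : ℝ)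
  norm_num at pairs unit
  have mono : ∑ j : Fin n, ((n : ℝ) - j) * 1 ≤ ∑ j, ((n : ℝ) - j) * x j := by
    refine Finset.sum_le_sum fun j _ => mul_le_mul_of_nonneg_left (hx1 j) ?_
    exact sub_nonneg.2 (by exact_mod_cast j.isLt.le)
  norm_num at mono
  linarith

/-- A pair scheduled in the wrong order costs at most the prediction errors of its two jobs. -/
theorem pair_delay_le (a b c d : ℝ) :
    (if c < d then a else b) ≤ a + (|a - c| + |b - d|) := by
  split_ifs with h
  · linarith [abs_nonneg (a - c), abs_nonneg (b - d)]
  · linarith [neg_abs_le (a - c), le_abs_self (b - d)]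

theorem spjf_competitive (n : ℕ) (hn : 1 ≤ n) (x y : Fin n → ℝ)
    (hmono : Monotone x) (hx1 : ∀ j, 1 ≤ x j) :
    ((∑ j, x j) +
        ∑ j, ∑ i, (if i < j then (if y i < y j then x i else x j) else 0)) ≤
      (1 + 2 * (∑ j, |x j - y j|) / n) * (∑ j, ((n : ℝ) - j) * x j) := by
  have delays : ∑ j, ∑ i, (if i < j then (if y i < y j then x i else x j) else 0) ≤
      ∑ j, ∑ i, (if i < j then x i else 0) + ((n : ℝ) - 1) * ∑ j, |x j - y j| := by
    rw [← sum_sum_ite_lt_add, ← Finset.sum_add_distrib]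
    refine Finset.sum_le_sum fun j _ => ?_
    rw [← Finset.sum_add_distrib]
    refine Finset.sum_le_sum fun i _ => ?_
    by_cases hij : i < j
    · simpa only [if_pos hij] using pair_delay_le (x i) (x j) (y i) (y j)
    · simp [hij]
  have hopt := opt_eq_sum_add_delays x
  have lower := opt_lower_bound x hx1
  set η := ∑ j, |x j - y j|
  set opt := ∑ j, ((n : ℝ) - j) * x j
  have hη : 0 ≤ η := Finset.sum_nonneg fun j _ => abs_nonneg _
  have hn' : (0 : ℝ) < n := by exact_mod_cast hn
  have excess : ((n : ℝ) + 1) * η ≤ 2 * η / n * opt := by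
    calc ((n : ℝ) + 1) * η = 2 * η / n * (n * (n + 1) / 2) := by field_simp
      _ ≤ 2 * η / n * opt := mul_le_mul_of_nonneg_left lower (by positivity)
  linarith
end

section
/- Let n ≥ 1, let λ ∈ (0, 1), let 0 ≤ x_1 ≤ x_2 ≤ ... ≤ x_n be real numbers, and let t_1, ..., t_n be nonnegative reals with t_k ≤ x_k/λ for all k. Then Σ_{j=1}^n x_j + Σ_{i<j} x_i + Σ_{k=1}^n t_k(1 − λ)(n − k)/2 ≤ ((1 + λ)/(2λ)) · Σ_{k=1}^n (n − k + 1)·x_k. -/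
/-- Exchanging the order of summation, `x i` is counted once for every index above `i`. -/
theorem sum_sum_ite_lt_eq (n : ℕ) (x : Fin n → ℝ) :
    (∑ j, ∑ i, (if i < j then x i else 0)) = ∑ k : Fin n, ((n : ℝ) - 1 - k) * x k := by
  rw [Finset.sum_comm]
  refine Finset.sum_congr rfl fun k _ => ?_
  have hk : (k : ℕ) + 1 ≤ n := k.isLt
  rw [← Finset.sum_filter, Finset.sum_const, nsmul_eq_mul, Finset.filter_lt_eq_Ioi,
    Fin.card_Ioi, Nat.sub_sub, Nat.add_comm 1, Nat.cast_sub hk]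
  push_cast
  ring

theorem delay_le_of_le_div {l m x t : ℝ} (hl0 : 0 < l) (hl1 : l < 1) (hm : 0 ≤ m)
    (hx : 0 ≤ x) (ht : t ≤ x / l) :
    x + m * x + t * (1 - l) * m / 2 ≤ (1 + l) / (2 * l) * ((m + 1) * x) := by
  have hdelay : t * (1 - l) * m / 2 ≤ x / l * (1 - l) * m / 2 := by
    have : 0 ≤ 1 - l := by linarith
    gcongr
  have hgap : (1 + l) / (2 * l) * ((m + 1) * x) - (x + m * x + x / l * (1 - l) * m / 2)
      = (1 - l) * x / (2 * l) := by
    field_simp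
    ring
  have hgap_nonneg : 0 ≤ (1 - l) * x / (2 * l) :=
    div_nonneg (mul_nonneg (by linarith) hx) (by linarith)
  linarith

theorem prr_consistency (n : ℕ) (hn : 1 ≤ n) (l : ℝ) (hl0 : 0 < l) (hl1 : l < 1)
    (x t : Fin n → ℝ) (hmono : Monotone x) (hx0 : ∀ j, 0 ≤ x j)
    (ht0 : ∀ k, 0 ≤ t k) (ht : ∀ k, t k ≤ x k / l) :
    ((∑ j, x j) + (∑ j, ∑ i, (if i < j then x i else 0)) +
        ∑ k, t k * (1 - l) * ((n : ℝ) - 1 - k) / 2) ≤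
      ((1 + l) / (2 * l)) * (∑ k, ((n : ℝ) - k) * x k) := by
  rw [sum_sum_ite_lt_eq, ← Finset.sum_add_distrib, ← Finset.sum_add_distrib, Finset.mul_sum]
  refine Finset.sum_le_sum fun k _ => ?_
  have hk : ((k : ℕ) : ℝ) + 1 ≤ n := by exact_mod_cast k.isLt
  have h := delay_le_of_le_div (m := (n : ℝ) - 1 - k) hl0 hl1 (by linarith) (hx0 k) (ht k)
  rwa [show (n : ℝ) - 1 - k + 1 = n - k by ring] at h
end

section
/- Let b ≥ 2 and k ≥ 1 be integers, and for 1 ≤ i ≤ k let q_i = ((b−1)/b)^{k−i} / (b(1 − (1 − 1/b)^k)). Then Σ_{i=1}^{k} (b + i − 1)·q_i = k / (1 − (1 − 1/b)^k). -/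
/-- The unnormalized expected cost of the randomized ski rental strategy. -/
theorem sum_Icc_add_sub_one_mul_pow {K : Type*} [Field K] {b : K} (hb : b ≠ 0) (k : ℕ) :
    ∑ i ∈ Finset.Icc 1 k, (b + i - 1) * ((b - 1) / b) ^ (k - i) = b * k := by
  induction k with
  | zero => simp
  | succ k ih =>
    have hstep : ∑ i ∈ Finset.Icc 1 k, (b + i - 1) * ((b - 1) / b) ^ (k + 1 - i) =
        (b - 1) / b * (b * k) := by
      rw [← ih, Finset.mul_sum]
      refine Finset.sum_congr rfl fun i hi => ?_
      rw [Nat.sub_add_comm (Finset.mem_Icc.mp hi).2, pow_succ]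
      ring
    rw [Finset.sum_Icc_succ_top (by omega), hstep, Nat.sub_self]
    push_cast
    field_simp
    ring

theorem ski_randomized_expected_cost (b k : ℕ) (hb : 2 ≤ b) (hk : 1 ≤ k) :
    ∑ i ∈ Finset.Icc 1 k,
        ((b : ℝ) + i - 1) *
          (((b - 1 : ℝ) / b) ^ (k - i) / (b * (1 - (1 - 1 / (b : ℝ)) ^ k))) =
      (k : ℝ) / (1 - (1 - 1 / (b : ℝ)) ^ k) := by
  have hb0 : (b : ℝ) ≠ 0 := Nat.cast_ne_zero.mpr (by omega)
  simp_rw [← mul_div_assoc]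
  rw [← Finset.sum_div, sum_Icc_add_sub_one_mul_pow hb0, mul_div_mul_left _ _ hb0]
end

section
/- Let b ≥ 2 and k ≥ 1 be integers, let x be an integer with 1 ≤ x ≤ k, and for 1 ≤ i ≤ k let q_i = ((b−1)/b)^{k−i} / (b(1 − (1 − 1/b)^k)). Then Σ_{i=1}^{x} (b + i − 1)·q_i + Σ_{i=x+1}^{k} x·q_i = x / (1 − (1 − 1/b)^k). -/
/-- Weighted geometric sum giving the cost of buying no later than day `x`. -/
theorem sum_Icc_one_add_sub_one_mul_pow {b r : ℝ} (hr : b * r = b - 1) {k x : ℕ} (hxk : x ≤ k) :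
    ∑ i ∈ Finset.Icc 1 x, (b + i - 1) * r ^ (k - i) = b * x * r ^ (k - x) := by
  induction x with
  | zero => simp
  | succ x ih =>
    rw [Finset.sum_Icc_succ_top (by omega), ih (by omega),
      show k - x = k - (x + 1) + 1 by omega, pow_succ]
    push_cast
    linear_combination (x * r ^ (k - (x + 1))) * hr

/-- Geometric sum giving the probability of buying after day `x`, up to normalization. -/
theorem sum_Icc_succ_pow_sub {b r : ℝ} (hr : b * r = b - 1) {k x : ℕ} (hxk : x ≤ k) :
    ∑ i ∈ Finset.Icc (x + 1) k, r ^ (k - i) = b * (1 - r ^ (k - x)) := by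
  induction k, hxk using Nat.le_induction with
  | base => simp
  | succ k hxk ih =>
    have hshift : ∑ i ∈ Finset.Icc (x + 1) k, r ^ (k + 1 - i) =
        r * ∑ i ∈ Finset.Icc (x + 1) k, r ^ (k - i) := by
      rw [Finset.mul_sum]
      refine Finset.sum_congr rfl fun i hi => ?_
      rw [Nat.succ_sub (Finset.mem_Icc.mp hi).2, pow_succ']
    rw [Finset.sum_Icc_succ_top (by omega), hshift, ih, Nat.succ_sub hxk, pow_succ, Nat.sub_self]
    linear_combination hr

theorem ski_randomized_expected_cost_small_x (b k x : ℕ) (hb : 2 ≤ b) (hk : 1 ≤ k)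
    (hx1 : 1 ≤ x) (hxk : x ≤ k) :
    ∑ i ∈ Finset.Icc 1 x,
        ((b : ℝ) + i - 1) *
          (((b - 1 : ℝ) / b) ^ (k - i) / (b * (1 - (1 - 1 / (b : ℝ)) ^ k))) +
      ∑ i ∈ Finset.Icc (x + 1) k,
        (x : ℝ) *
          (((b - 1 : ℝ) / b) ^ (k - i) / (b * (1 - (1 - 1 / (b : ℝ)) ^ k))) =
      (x : ℝ) / (1 - (1 - 1 / (b : ℝ)) ^ k) := by
  have hb0 : (b : ℝ) ≠ 0 := by
    have : b ≠ 0 := by omega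
    exact_mod_cast this
  have hr : (b : ℝ) * ((b - 1 : ℝ) / b) = b - 1 := mul_div_cancel₀ _ hb0
  simp only [← mul_div_assoc]
  rw [← Finset.sum_div, ← Finset.sum_div, ← Finset.mul_sum, ← add_div,
    sum_Icc_one_add_sub_one_mul_pow hr hxk, sum_Icc_succ_pow_sub hr hxk,
    ← mul_div_mul_left (x : ℝ) _ hb0]
  congr 1
  ring
end

section
/- Let b ≥ 2 be an integer, λ ∈ (1/b, 1) a real number, and set k = ⌊λb⌋. Let x be an integer with 1 ≤ x < k and let η be a real number with η ≥ b − k. Then x / (1 − (1 − 1/b)^k) ≤ (λ/(1 − e^{−λ})) · (x + η). -/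
/-- The function `t ↦ t / (1 - exp (-t))` is monotone on the positive reals, in cross-multiplied
form. -/
theorem mul_one_sub_exp_neg_le {s t : ℝ} (hs : 0 ≤ s) (hst : s ≤ t) (ht : 0 < t) :
    s * (1 - Real.exp (-t)) ≤ t * (1 - Real.exp (-s)) := by
  have hconv := convexOn_exp.2 (Set.mem_univ 0) (Set.mem_univ (-t))
    (sub_nonneg.2 ((div_le_one ht).2 hst)) (div_nonneg hs ht.le) (sub_add_cancel 1 (s / t))
  have hpoint : (1 - s / t) • (0 : ℝ) + (s / t) • (-t) = -s := by
    simp only [smul_eq_mul]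
    field_simp
    ring
  rw [hpoint, Real.exp_zero] at hconv
  simp only [smul_eq_mul, mul_one] at hconv
  have hscaled := mul_le_mul_of_nonneg_left hconv ht.le
  have hexpand : t * (1 - s / t + s / t * Real.exp (-t)) = t - s + s * Real.exp (-t) := by
    field_simp
  linarith

theorem one_sub_one_div_pow_le_exp {b : ℕ} (hb : 1 ≤ b) (k : ℕ) :
    (1 - 1 / (b : ℝ)) ^ k ≤ Real.exp (-(k / b)) := by
  have hb' : (1 : ℝ) ≤ b := by exact_mod_cast hb
  have hnonneg : 0 ≤ 1 - 1 / (b : ℝ) := sub_nonneg.2 ((div_le_one (by linarith)).2 hb')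
  calc (1 - 1 / (b : ℝ)) ^ k ≤ Real.exp (-(1 / b)) ^ k :=
        pow_le_pow_left₀ hnonneg (Real.one_sub_le_exp_neg _) k
    _ = Real.exp (-(k / b)) := by
        rw [← Real.exp_nat_mul]
        congr 1
        ring

theorem ski_randomized_case_ii (b : ℕ) (hb : 2 ≤ b) (l : ℝ)
    (hl : 1 / (b : ℝ) < l) (hl1 : l < 1) (x : ℕ)
    (hx1 : 1 ≤ x) (hxk : x < ⌊l * b⌋₊) (η : ℝ) (hη : (b : ℝ) - ⌊l * b⌋₊ ≤ η) :
    (x : ℝ) / (1 - (1 - 1 / (b : ℝ)) ^ (⌊l * b⌋₊)) ≤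
      (l / (1 - Real.exp (-l))) * ((x : ℝ) + η) := by
  have hb0 : (0 : ℝ) < b := by exact_mod_cast (by omega : 0 < b)
  have hl0 : 0 < l := lt_trans (by positivity) hl
  have hkl : (⌊l * b⌋₊ : ℝ) ≤ l * b := Nat.floor_le (by positivity)
  generalize ⌊l * b⌋₊ = k at *
  have hx : (x : ℝ) ≤ k := by exact_mod_cast hxk.le
  have hk0 : (0 : ℝ) < k := by exact_mod_cast (by omega : 0 < k)
  have hkb : (k : ℝ) ≤ b := by nlinarith
  have hpow := one_sub_one_div_pow_le_exp (by omega : 1 ≤ b) k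
  have hexp : Real.exp (-(k / b : ℝ)) < 1 := Real.exp_lt_one_iff.2 (neg_lt_zero.2 (by positivity))
  have hE : 0 < 1 - Real.exp (-l) := sub_pos.2 (Real.exp_lt_one_iff.2 (neg_lt_zero.2 hl0))
  have hmono := mul_one_sub_exp_neg_le (s := k / b) (by positivity) ((div_le_iff₀ hb0).2 hkl) hl0
  generalize (1 - 1 / (b : ℝ)) ^ k = p at *
  generalize 1 - Real.exp (-l) = E at *
  have hD : 0 < 1 - p := by linarith
  have hratio : k * E ≤ l * b * (1 - p) := by
    have h : k / b * E ≤ l * (1 - p) :=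
      hmono.trans (mul_le_mul_of_nonneg_left (by linarith) hl0.le)
    rw [div_mul_eq_mul_div, div_le_iff₀ hb0] at h
    linarith
  have hlin : (x : ℝ) * b ≤ k * (x + η) := by nlinarith
  rw [div_mul_eq_mul_div, div_le_div_iff₀ hD hE]
  refine le_of_mul_le_mul_left ?_ hk0
  calc k * (x * E) = x * (k * E) := by ring
    _ ≤ x * (l * b * (1 - p)) := mul_le_mul_of_nonneg_left hratio (Nat.cast_nonneg x)
    _ = l * (1 - p) * (x * b) := by ring
    _ ≤ l * (1 - p) * (k * (x + η)) := mul_le_mul_of_nonneg_left hlin (by positivity)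
    _ = k * (l * (x + η) * (1 - p)) := by ring
end

section
/- Let b ≥ 2 be an integer, λ ∈ (1/b, 1) a real number, and set ℓ = ⌈b/λ⌉. Let x and y be integers with 1 ≤ x < ℓ and 1 ≤ y < b. Then x / (1 − (1 − 1/b)^ℓ) ≤ (λ/(1 − e^{−λ})) · (min(b, x) + |y − x|). -/
/-- For `u ≥ 4/3`, the cubic Taylor bounds on both exponentials suffice. -/
lemma one_sub_exp_neg_inv_le_of_four_thirds_le {u : ℝ} (hu : 4 / 3 ≤ u) :
    u * (1 - Real.exp (-u⁻¹)) ≤ 1 - Real.exp (-u) := by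
  have hu0 : 0 < u := by linarith
  have hcubic : 1 + u + u ^ 2 / 2 + u ^ 3 / 6 ≤ Real.exp u := by
    have h := Real.sum_le_exp_of_nonneg hu0.le 4
    simpa [Finset.sum_range_succ, Nat.factorial] using h
  have hexp : Real.exp (-u) ≤ (3 * u - 1) / (6 * u ^ 2) := by
    rw [Real.exp_neg, inv_le_comm₀ (Real.exp_pos u) (by apply div_pos <;> nlinarith), inv_div,
      div_le_iff₀ (by linarith)]
    have h := mul_le_mul_of_nonneg_right hcubic (by linarith : 0 ≤ 3 * u - 1)
    have hpoly : 0 ≤ (u - 4 / 3) * (u ^ 3 / 2 + 2 * u ^ 2 - 5 / 6 * u + 8 / 9) := by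
      apply mul_nonneg <;> nlinarith [pow_pos hu0 3]
    nlinarith
  have hinv : 1 - u⁻¹ + u⁻¹ ^ 2 / 2 - u⁻¹ ^ 3 / 6 ≤ Real.exp (-u⁻¹) := by
    have hs : 0 < u⁻¹ := inv_pos.mpr hu0
    have hs1 : u⁻¹ ≤ 1 := inv_le_one_of_one_le₀ (by linarith)
    generalize u⁻¹ = s at hs hs1
    have habs : |-s| = s := by rw [abs_neg, abs_of_pos hs]
    have h := Real.exp_bound (x := -s) (by rwa [habs]) (n := 5) (by norm_num)
    rw [habs] at h
    simp only [Finset.sum_range_succ, Finset.sum_range_zero, Nat.factorial] at h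
    norm_num at h
    have hs5 : s ^ 5 ≤ s ^ 4 := pow_le_pow_of_le_one hs.le hs1 (by norm_num)
    nlinarith [(abs_le.mp h).1, pow_pos hs 4]
  have hmul := mul_le_mul_of_nonneg_left hinv hu0.le
  have heq : u * (1 - u⁻¹ + u⁻¹ ^ 2 / 2 - u⁻¹ ^ 3 / 6) = u - 1 + (3 * u - 1) / (6 * u ^ 2) := by
    field_simp
    ring
  linarith

/-- For `u` close to `1`, expand both exponentials around `1`. -/
lemma one_sub_exp_neg_inv_le_of_le_four_thirds {u : ℝ} (hu1 : 1 ≤ u) (hu : u ≤ 4 / 3) :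
    u * (1 - Real.exp (-u⁻¹)) ≤ 1 - Real.exp (-u) := by
  obtain ⟨v, rfl⟩ : ∃ v, u = 1 + v := ⟨u - 1, by ring⟩
  have hv : 0 ≤ v := by linarith
  have he := Real.exp_one_lt_d9
  have hright : Real.exp (-(1 + v)) * Real.exp 1 ≤ 1 + (2 - Real.exp 1) * v := by
    rw [← Real.exp_add, show -(1 + v) + 1 = -v by ring, Real.exp_neg]
    refine (inv_anti₀ (by positivity) (Real.quadratic_le_exp_of_nonneg hv)).trans ?_
    rw [inv_le_iff_one_le_mul₀ (by positivity)]
    have h : 0 ≤ v * ((3 - Real.exp 1) + v / 2 + (2 - Real.exp 1) * v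
        + (2 - Real.exp 1) * v ^ 2 / 2) := by
      apply mul_nonneg hv
      have hv2 : v ^ 2 ≤ 1 / 9 := by nlinarith
      nlinarith [mul_nonneg (sub_nonneg.mpr he.le) hv,
        mul_nonneg (sub_nonneg.mpr he.le) (sq_nonneg v)]
    nlinarith
  have hleft : 1 + 2 * v ≤ (1 + v) * Real.exp (-(1 + v)⁻¹) * Real.exp 1 := by
    rw [mul_assoc, ← Real.exp_add]
    have h := mul_le_mul_of_nonneg_left (Real.add_one_le_exp (-(1 + v)⁻¹ + 1))
      (by linarith : 0 ≤ 1 + v)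
    have heq : (1 + v) * (-(1 + v)⁻¹ + 1 + 1) = 1 + 2 * v := by
      field_simp
      ring
    linarith
  refine le_of_mul_le_mul_right ?_ (Real.exp_pos 1)
  nlinarith

lemma one_sub_exp_neg_le_mul_one_sub_exp_neg_inv {l : ℝ} (hl : 0 < l) (hl1 : l ≤ 1) :
    1 - Real.exp (-l) ≤ l * (1 - Real.exp (-l⁻¹)) := by
  have hu1 : 1 ≤ l⁻¹ := (one_le_inv₀ hl).mpr hl1
  have h : l⁻¹ * (1 - Real.exp (-l)) ≤ 1 - Real.exp (-l⁻¹) := by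
    rcases le_total (4 / 3) l⁻¹ with hu | hu
    · simpa using one_sub_exp_neg_inv_le_of_four_thirds_le hu
    · simpa using one_sub_exp_neg_inv_le_of_le_four_thirds hu1 hu
  rwa [inv_mul_le_iff₀ hl] at h

theorem ski_randomized_case_iii (b : ℕ) (hb : 2 ≤ b) (l : ℝ)
    (hl : 1 / (b : ℝ) < l) (hl1 : l < 1) (x y : ℕ)
    (hx1 : 1 ≤ x) (hxl : x < ⌈(b : ℝ) / l⌉₊) (hy1 : 1 ≤ y) (hyb : y < b) :
    (x : ℝ) / (1 - (1 - 1 / (b : ℝ)) ^ (⌈(b : ℝ) / l⌉₊)) ≤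
      (l / (1 - Real.exp (-l))) * ((min b x : ℕ) + |(y : ℝ) - x|) := by
  have hb0 : (0 : ℝ) < b := by positivity
  have hl0 : 0 < l := lt_trans (by positivity) hl
  have hpow : (1 - 1 / (b : ℝ)) ^ ⌈(b : ℝ) / l⌉₊ ≤ Real.exp (-l⁻¹) := by
    have hbase : 0 ≤ 1 - 1 / (b : ℝ) := by linarith
    refine (pow_le_pow_left₀ hbase (Real.one_sub_le_exp_neg _) _).trans ?_
    rw [← Real.exp_nat_mul, Real.exp_le_exp]
    have h := mul_le_mul_of_nonneg_right (Nat.le_ceil ((b : ℝ) / l))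
      (by positivity : 0 ≤ 1 / (b : ℝ))
    have heq : (b : ℝ) / l * (1 / b) = l⁻¹ := by field_simp
    linarith
  have hden : 0 < 1 - Real.exp (-l) := by simpa using hl0
  have hden' : 0 < 1 - Real.exp (-l⁻¹) := by simpa using hl0
  have hopt : (x : ℝ) ≤ (min b x : ℕ) + |(y : ℝ) - x| := by
    rcases le_total b x with h | h
    · rw [min_eq_left h]
      have hyb' : (y : ℝ) < b := by exact_mod_cast hyb
      linarith [neg_le_abs ((y : ℝ) - x)]
    · rw [min_eq_right h]
      linarith [abs_nonneg ((y : ℝ) - x)]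
  have hratio : 1 / (1 - (1 - 1 / (b : ℝ)) ^ ⌈(b : ℝ) / l⌉₊) ≤ l / (1 - Real.exp (-l)) := by
    rw [div_le_div_iff₀ (by linarith) hden, one_mul]
    refine (one_sub_exp_neg_le_mul_one_sub_exp_neg_inv hl0 hl1.le).trans ?_
    gcongr
  calc (x : ℝ) / (1 - (1 - 1 / (b : ℝ)) ^ ⌈(b : ℝ) / l⌉₊)
      = 1 / (1 - (1 - 1 / (b : ℝ)) ^ ⌈(b : ℝ) / l⌉₊) * x := by ring
    _ ≤ _ := by gcongr
end

section
/- Let b ≥ 2 be an integer, λ ∈ (1/b, 1) a real number, and set ℓ = ⌈b/λ⌉. Then ℓ / (1 − (1 − 1/b)^ℓ) ≤ ((1 + 1/b)/(1 − e^{−(λ − 1/b)})) · b. -/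
open Real in
/-- On the unit interval, `exp (-x)` is at least `1 - x + exp (-1) * x ^ 2`, with equality at both
endpoints. -/
lemma exp_mul_one_sub_add_sq_le_one {x : ℝ} (hx0 : 0 ≤ x) (hx1 : x ≤ 1) :
    exp x * (1 - x + exp (-1) * x ^ 2) ≤ 1 := by
  have hderiv : ∀ y : ℝ, HasDerivAt (fun y => exp y * (1 - y + exp (-1) * y ^ 2))
      (y * exp y * (exp (-1) * (y + 2) - 1)) y := fun y => by
    have h := (Real.hasDerivAt_exp y).mul
      (((hasDerivAt_const y (1 : ℝ)).sub (hasDerivAt_id y)).add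
        ((hasDerivAt_pow 2 y).const_mul (exp (-1))))
    refine h.congr_deriv ?_
    simp
    ring
  have hcont : Continuous (fun y => exp y * (1 - y + exp (-1) * y ^ 2)) := by fun_prop
  have hc : 0 < exp (-1) := exp_pos _
  rcases le_total (exp (-1) * (x + 2)) 1 with h | h
  · have hanti : AntitoneOn (fun y => exp y * (1 - y + exp (-1) * y ^ 2)) (Set.Icc 0 x) := by
      refine antitoneOn_of_deriv_nonpos (convex_Icc 0 x) hcont.continuousOn
        (fun y _ => (hderiv y).differentiableAt.differentiableWithinAt) fun y hy => ?_
      rw [interior_Icc] at hy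
      rw [(hderiv y).deriv]
      refine mul_nonpos_of_nonneg_of_nonpos (mul_nonneg hy.1.le (exp_pos y).le) ?_
      nlinarith [hy.2]
    simpa using hanti ⟨le_rfl, hx0⟩ ⟨hx0, le_rfl⟩ hx0
  · have hmono : MonotoneOn (fun y => exp y * (1 - y + exp (-1) * y ^ 2)) (Set.Icc x 1) := by
      refine monotoneOn_of_deriv_nonneg (convex_Icc x 1) hcont.continuousOn
        (fun y _ => (hderiv y).differentiableAt.differentiableWithinAt) fun y hy => ?_
      rw [interior_Icc] at hy
      rw [(hderiv y).deriv]
      refine mul_nonneg (mul_nonneg (hx0.trans hy.1.le) (exp_pos y).le) ?_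
      nlinarith [hy.1]
    simpa [← exp_add] using hmono ⟨le_rfl, hx1⟩ ⟨hx1, le_rfl⟩ hx1

open Real in
lemma one_sub_exp_neg_le_mul_one_sub_exp_neg_inv_s12 {x : ℝ} (hx0 : 0 < x) (hx1 : x ≤ 1) :
    1 - exp (-x) ≤ x * (1 - exp (-x⁻¹)) := by
  have hquad : 1 - x + exp (-1) * x ^ 2 ≤ exp (-x) := by
    rw [exp_neg x, ← one_div, le_div_iff₀' (exp_pos x)]
    exact exp_mul_one_sub_add_sq_le_one hx0.le hx1
  have hinv : exp (-x⁻¹) ≤ exp (-1) * x := by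
    calc exp (-x⁻¹) ≤ exp (-1 + log x) :=
          exp_le_exp.2 (by linarith [one_sub_inv_le_log_of_pos hx0])
      _ = exp (-1) * x := by rw [exp_add, exp_log hx0]
  nlinarith [mul_le_mul_of_nonneg_left hinv hx0.le]

lemma one_sub_inv_pow_le_exp_neg_div {b : ℝ} (hb : 1 ≤ b) (n : ℕ) :
    (1 - 1 / b) ^ n ≤ Real.exp (-(n / b)) := by
  have hnonneg : 0 ≤ 1 - 1 / b := by
    rw [sub_nonneg, div_le_one (by linarith)]
    exact hb
  calc (1 - 1 / b) ^ n ≤ Real.exp (-(1 / b)) ^ n :=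
        pow_le_pow_left₀ hnonneg (Real.one_sub_le_exp_neg _) n
    _ = Real.exp (-(n / b)) := by
        rw [← Real.exp_nat_mul]
        ring_nf

theorem ski_randomized_case_iv_robust (b : ℕ) (hb : 2 ≤ b) (l : ℝ)
    (hl : 1 / (b : ℝ) < l) (hl1 : l < 1) :
    (⌈(b : ℝ) / l⌉₊ : ℝ) / (1 - (1 - 1 / (b : ℝ)) ^ (⌈(b : ℝ) / l⌉₊)) ≤
      ((1 + 1 / (b : ℝ)) / (1 - Real.exp (-(l - 1 / (b : ℝ))))) * b := by
  have hb2 : (2 : ℝ) ≤ b := by exact_mod_cast hb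
  have hb0 : (0 : ℝ) < b := by linarith
  have hinvb : 0 < 1 / (b : ℝ) := by positivity
  have hl0 : 0 < l := hinvb.trans hl
  set n := ⌈(b : ℝ) / l⌉₊
  have hn_lower : (b : ℝ) / l ≤ n := Nat.le_ceil _
  have hn_upper : (n : ℝ) < b / l + 1 := Nat.ceil_lt_add_one (by positivity)
  have hpow : (1 - 1 / (b : ℝ)) ^ n ≤ Real.exp (-l⁻¹) := by
    refine (one_sub_inv_pow_le_exp_neg_div (by linarith) n).trans (Real.exp_le_exp.2 ?_)
    rw [neg_le_neg_iff, le_div_iff₀ hb0, inv_mul_eq_div]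
    exact hn_lower
  have hkey := one_sub_exp_neg_le_mul_one_sub_exp_neg_inv_s12 hl0 hl1.le
  have hexp : Real.exp (-l) ≤ Real.exp (-(l - 1 / (b : ℝ))) :=
    Real.exp_le_exp.2 (by linarith)
  have hden : 0 < 1 - Real.exp (-(l - 1 / (b : ℝ))) :=
    sub_pos.2 (Real.exp_lt_one_iff.2 (by linarith))
  have hbound : 1 - Real.exp (-(l - 1 / (b : ℝ))) ≤ l * (1 - (1 - 1 / (b : ℝ)) ^ n) := by
    nlinarith [mul_le_mul_of_nonneg_left hpow hl0.le]
  have hden' : 0 < 1 - (1 - 1 / (b : ℝ)) ^ n :=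
    pos_of_mul_pos_right (hden.trans_le hbound) hl0.le
  have hnl : n * l ≤ b + 1 := by
    have h := mul_le_mul_of_nonneg_right hn_upper.le hl0.le
    rw [add_mul, div_mul_cancel₀ _ hl0.ne'] at h
    linarith
  have hnum : (1 + 1 / (b : ℝ)) * b = b + 1 := by field_simp
  rw [div_mul_eq_mul_div, hnum, div_le_div_iff₀ hden' hden]
  calc (n : ℝ) * (1 - Real.exp (-(l - 1 / (b : ℝ))))
      ≤ n * (l * (1 - (1 - 1 / (b : ℝ)) ^ n)) :=
        mul_le_mul_of_nonneg_left hbound n.cast_nonneg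
    _ = n * l * (1 - (1 - 1 / (b : ℝ)) ^ n) := by ring
    _ ≤ (b + 1) * (1 - (1 - 1 / (b : ℝ)) ^ n) :=
        mul_le_mul_of_nonneg_right hnl hden'.le
end

section
/- Let b ≥ 2 be an integer, λ ∈ (1/b, 1) a real number, set ℓ = ⌈b/λ⌉, and let η be a real number with η ≥ ℓ − b. Then ℓ / (1 − (1 − 1/b)^ℓ) ≤ (λ/(1 − e^{−λ})) · (b + η). -/
theorem one_sub_exp_neg_le_mul_of_le {l : ℝ} (h0 : 0 < l) (h1 : l ≤ 2 / 5) :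
    1 - Real.exp (-l) ≤ l * (1 - Real.exp (-(1 / l))) := by
  have hexp : 1 - l + l ^ 2 / 2 - 2 / 9 * l ^ 3 ≤ Real.exp (-l) := by
    have h := Real.exp_bound (x := -l) (by rw [abs_neg, abs_of_pos h0]; linarith)
      (n := 3) (by norm_num)
    rw [abs_neg, abs_of_pos h0] at h
    norm_num [Finset.sum_range_succ, Nat.factorial] at h
    have := (abs_le.1 h).1
    linarith
  have hquad : 1 + 1 / l + (1 / l) ^ 2 / 2 ≤ Real.exp (1 / l) :=
    Real.quadratic_le_exp_of_nonneg (by positivity)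
  have hinv : Real.exp (-(1 / l)) ≤ l / 2 - 2 / 9 * l ^ 2 := by
    rw [Real.exp_neg]
    refine (inv_anti₀ (by positivity) hquad).trans ?_
    rw [inv_le_iff_one_le_mul₀ (by positivity)]
    have : (l / 2 - 2 / 9 * l ^ 2) * (1 + 1 / l + (1 / l) ^ 2 / 2) =
        (9 - 4 * l) * (2 * l ^ 2 + 2 * l + 1) / (36 * l) := by
      field_simp
      ring
    rw [this, le_div_iff₀ (by positivity)]
    nlinarith [sq_nonneg l, mul_nonneg h0.le (sub_nonneg.2 h1),
      mul_nonneg (sq_nonneg l) (sub_nonneg.2 h1)]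
  nlinarith [mul_le_mul_of_nonneg_left hinv h0.le]

theorem one_sub_exp_neg_le_mul_of_ge {l : ℝ} (h0 : 2 / 5 ≤ l) (h1 : l ≤ 1) :
    1 - Real.exp (-l) ≤ l * (1 - Real.exp (-(1 / l))) := by
  have hl : 0 < l := by linarith
  obtain ⟨s, rfl⟩ : ∃ s, l = 1 - s := ⟨1 - l, by ring⟩
  have hs : 0 ≤ s := by linarith
  have hexp : 1 + s + s ^ 2 / 2 ≤ Real.exp s := Real.quadratic_le_exp_of_nonneg hs
  have hquad := Real.quadratic_le_exp_of_nonneg (x := s / (1 - s)) (by positivity)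
  have hinv : (1 - s) * Real.exp (-(s / (1 - s))) ≤ 1 - 1.7183 * s + s ^ 2 / 2 := by
    rw [Real.exp_neg]
    refine (mul_le_mul_of_nonneg_left (inv_anti₀ (by positivity) hquad) hl.le).trans ?_
    rw [← div_eq_mul_inv, div_le_iff₀ (by positivity)]
    have : (1 - 1.7183 * s + s ^ 2 / 2) * (1 + s / (1 - s) + (s / (1 - s)) ^ 2 / 2) =
        (1 - 1.7183 * s + s ^ 2 / 2) * (1 - s + s ^ 2 / 2) / (1 - s) ^ 2 := by
      field_simp
      ring
    rw [this, le_div_iff₀ (by positivity)]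
    have hpoly : 0 ≤ 0.2817 * (1 - s) - 0.35915 * s ^ 2 + s ^ 3 / 4 := by
      nlinarith [mul_nonneg hs (sq_nonneg (s - 3 / 5)), sq_nonneg (s - 3 / 5)]
    nlinarith [mul_nonneg hs hpoly]
  have he : Real.exp 1 < 2.7183 := Real.exp_one_lt_d9.trans (by norm_num)
  have hkey : (1 - s) * Real.exp (-(s / (1 - s))) ≤ Real.exp s - Real.exp 1 * s := by
    nlinarith
  have hsplit : Real.exp (-(1 / (1 - s))) = Real.exp (-1) * Real.exp (-(s / (1 - s))) := by
    rw [← Real.exp_add]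
    congr 1
    field_simp
    ring
  have hsplit' : Real.exp (-(1 - s)) = Real.exp (-1) * Real.exp s := by
    rw [← Real.exp_add]
    congr 1
    ring
  have hone : Real.exp (-1) * Real.exp 1 = 1 := by simp [← Real.exp_add]
  rw [hsplit, hsplit']
  linear_combination Real.exp (-1) * hkey - s * hone

theorem one_sub_exp_neg_le_mul_one_sub_exp_neg_inv_s13 {l : ℝ} (h0 : 0 < l) (h1 : l ≤ 1) :
    1 - Real.exp (-l) ≤ l * (1 - Real.exp (-(1 / l))) := by
  rcases le_total l (2 / 5) with h | h
  · exact one_sub_exp_neg_le_mul_of_le h0 h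
  · exact one_sub_exp_neg_le_mul_of_ge h h1

theorem one_sub_inv_pow_le_exp_neg {b : ℝ} (hb : 1 ≤ b) {l : ℝ} {n : ℕ} (hn : b / l ≤ n) :
    (1 - 1 / b) ^ n ≤ Real.exp (-(1 / l)) := by
  have hb0 : 0 < b := by linarith
  calc (1 - 1 / b) ^ n ≤ Real.exp (-(1 / b)) ^ n :=
        pow_le_pow_left₀ (sub_nonneg.2 ((div_le_one hb0).2 hb)) (Real.one_sub_le_exp_neg _) n
    _ = Real.exp (-(n / b)) := by
        rw [← Real.exp_nat_mul]
        congr 1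
        ring
    _ ≤ Real.exp (-(1 / l)) := by
        rw [Real.exp_le_exp, neg_le_neg_iff, le_div_iff₀ hb0]
        linarith [show 1 / l * b = b / l by ring]

theorem ski_randomized_case_iv_consistent (b : ℕ) (hb : 2 ≤ b) (l : ℝ)
    (hl : 1 / (b : ℝ) < l) (hl1 : l < 1) (η : ℝ)
    (hη : (⌈(b : ℝ) / l⌉₊ : ℝ) - b ≤ η) :
    (⌈(b : ℝ) / l⌉₊ : ℝ) / (1 - (1 - 1 / (b : ℝ)) ^ (⌈(b : ℝ) / l⌉₊)) ≤
      (l / (1 - Real.exp (-l))) * ((b : ℝ) + η) := by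
  have hb1 : (1 : ℝ) ≤ b := by exact_mod_cast (by omega : 1 ≤ b)
  have h0 : 0 < l := lt_of_le_of_lt (by positivity) hl
  have hpow := one_sub_inv_pow_le_exp_neg hb1 (Nat.le_ceil ((b : ℝ) / l))
  have hmain := one_sub_exp_neg_le_mul_one_sub_exp_neg_inv_s13 h0 hl1.le
  have hpos : 0 < 1 - Real.exp (-l) := by
    rw [sub_pos, Real.exp_lt_one_iff]
    linarith
  have hpos' : 0 < 1 - Real.exp (-(1 / l)) := by
    rw [sub_pos, Real.exp_lt_one_iff, neg_lt_zero]
    positivity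
  generalize ⌈(b : ℝ) / l⌉₊ = n at *
  calc (n : ℝ) / (1 - (1 - 1 / (b : ℝ)) ^ n) ≤ n / (1 - Real.exp (-(1 / l))) := by gcongr
    _ ≤ l / (1 - Real.exp (-l)) * n := by
        rw [div_mul_eq_mul_div, div_le_div_iff₀ hpos' hpos]
        nlinarith [mul_le_mul_of_nonneg_left hmain (Nat.cast_nonneg (α := ℝ) n)]
    _ ≤ l / (1 - Real.exp (-l)) * (b + η) := by
        gcongr
        linarith
end

section
/- For every real number λ with 0 < λ ≤ 1, it holds that 1/(1 − e^{−1/λ}) ≤ λ/(1 − e^{−λ}); equivalently, 1 − e^{−1/λ} − 1/λ + e^{−λ}/λ ≥ 0. -/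
/-- The `(1, 1)` Padé approximant of `exp` is an upper bound on `[0, 2)`. -/
theorem two_sub_mul_exp_le {x : ℝ} (hx0 : 0 ≤ x) (hx2 : x < 2) :
    (2 - x) * Real.exp x ≤ 2 + x := by
  have h2 : 0 < 2 - x := by linarith
  have hlog := Real.le_log_one_add_of_nonneg (x := 2 * x / (2 - x)) (by positivity)
  have harg : 2 * (2 * x / (2 - x)) / (2 * x / (2 - x) + 2) = x := by
    field_simp
    ring
  rw [harg, Real.le_log_iff_exp_le (by positivity)] at hlog
  calc (2 - x) * Real.exp x ≤ (2 - x) * (1 + 2 * x / (2 - x)) := by gcongr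
    _ = 2 + x := by
      field_simp
      ring

theorem antitoneOn_exp_neg_sub_one_add_div_sq :
    AntitoneOn (fun x : ℝ => (Real.exp (-x) - 1 + x) / x ^ 2) (Set.Ioo 0 2) := by
  have hderiv : ∀ x : ℝ, x ≠ 0 → HasDerivAt (fun x : ℝ => (Real.exp (-x) - 1 + x) / x ^ 2)
      (((-Real.exp (-x) + 1) * x ^ 2 - (Real.exp (-x) - 1 + x) * (2 * x)) / (x ^ 2) ^ 2) x := by
    intro x hx
    have hnum : HasDerivAt (fun x : ℝ => Real.exp (-x) - 1 + x) (-Real.exp (-x) + 1) x := by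
      simpa using ((hasDerivAt_neg x).exp.sub_const 1).fun_add (hasDerivAt_id' x)
    have hden : HasDerivAt (fun x : ℝ => x ^ 2) (2 * x) x := by
      simpa using hasDerivAt_pow 2 x
    exact hnum.div hden (pow_ne_zero 2 hx)
  apply antitoneOn_of_deriv_nonpos (convex_Ioo 0 2)
  · exact fun x hx => (hderiv x hx.1.ne').continuousAt.continuousWithinAt
  · rw [interior_Ioo]
    exact fun x hx => (hderiv x hx.1.ne').differentiableAt.differentiableWithinAt
  · rw [interior_Ioo]
    rintro x ⟨hx0, hx2⟩
    rw [(hderiv x hx0.ne').deriv]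
    apply div_nonpos_of_nonpos_of_nonneg _ (by positivity)
    have hpade : 2 - x ≤ (2 + x) * Real.exp (-x) := by
      rw [Real.exp_neg, ← div_eq_mul_inv, le_div_iff₀ (Real.exp_pos x)]
      exact two_sub_mul_exp_le hx0.le hx2
    nlinarith [mul_le_mul_of_nonneg_left hpade hx0.le]

theorem sq_mul_exp_neg_one_le {x : ℝ} (hx0 : 0 < x) (hx1 : x ≤ 1) :
    x ^ 2 * Real.exp (-1) ≤ Real.exp (-x) - 1 + x := by
  have h := antitoneOn_exp_neg_sub_one_add_div_sq (a := x) (b := 1)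
    ⟨hx0, by linarith⟩ ⟨one_pos, one_lt_two⟩ hx1
  simp only [one_pow, div_one, sub_add_cancel] at h
  rw [le_div_iff₀ (by positivity)] at h
  linarith

theorem exp_neg_one_div_le {x : ℝ} (hx0 : 0 < x) :
    Real.exp (-(1 / x)) ≤ x * Real.exp (-1) := by
  have h := Real.one_sub_inv_le_log_of_pos hx0
  rw [Real.le_log_iff_exp_le hx0] at h
  calc Real.exp (-(1 / x)) = Real.exp (1 - x⁻¹) * Real.exp (-1) := by
        rw [← Real.exp_add]
        ring_nf
    _ ≤ x * Real.exp (-1) := by gcongr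

theorem key_scalar_ineq (l : ℝ) (hl0 : 0 < l) (hl1 : l ≤ 1) :
    1 / (1 - Real.exp (-(1 / l))) ≤ l / (1 - Real.exp (-l)) ∧
    1 - Real.exp (-(1 / l)) - 1 / l + Real.exp (-l) / l ≥ 0 := by
  have key : 1 - Real.exp (-l) ≤ l * (1 - Real.exp (-(1 / l))) := by
    nlinarith [sq_mul_exp_neg_one_le hl0 hl1,
      mul_le_mul_of_nonneg_left (exp_neg_one_div_le hl0) hl0.le]
  have hinv : 0 < 1 / l := by positivity
  have hpos : 0 < 1 - Real.exp (-(1 / l)) := by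
    simpa only [sub_pos, Real.exp_lt_one_iff, neg_lt_zero] using hinv
  have hpos' : 0 < 1 - Real.exp (-l) := by
    simpa only [sub_pos, Real.exp_lt_one_iff, neg_lt_zero] using hl0
  constructor
  · rw [div_le_div_iff₀ hpos hpos', one_mul]
    exact key
  · have hsum : 1 - Real.exp (-(1 / l)) - 1 / l + Real.exp (-l) / l =
        (l * (1 - Real.exp (-(1 / l))) - (1 - Real.exp (-l))) / l := by
      rw [eq_div_iff hl0.ne', add_mul, sub_mul, div_mul_cancel₀ _ hl0.ne',
        div_mul_cancel₀ _ hl0.ne']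
      ring
    rw [hsum]
    exact div_nonneg (sub_nonneg.2 key) hl0.le
end

section
/- For every real number x with 0 < x ≤ 1, it holds that 1 − 1/x + e^{−x}/x ≥ x/e. -/
theorem hasDerivAt_exp_mul_quadratic (c x : ℝ) :
    HasDerivAt (fun y => Real.exp y * (1 - y + c * y ^ 2))
      (Real.exp x * (x * (2 * c - 1 + c * x))) x := by
  have hq : HasDerivAt (fun y : ℝ => 1 - y + c * y ^ 2) (-1 + c * (2 * x)) x := by
    exact (((hasDerivAt_id x).const_sub 1).add ((hasDerivAt_pow 2 x).const_mul c)).congr_deriv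
      (by simp)
  exact ((Real.hasDerivAt_exp x).mul hq).congr_deriv (by ring)

/-- The function `exp y * (1 - y + y ^ 2 / e)` takes the value `1` at `0` and `1`; it decreases
up to `e - 2` and increases afterwards. -/
theorem exp_mul_quadratic_le_one {x : ℝ} (hx0 : 0 ≤ x) (hx1 : x ≤ 1) :
    Real.exp x * (1 - x + (Real.exp 1)⁻¹ * x ^ 2) ≤ 1 := by
  set c := (Real.exp 1)⁻¹
  have hc0 : 0 < c := by positivity
  have hce : c * Real.exp 1 = 1 := inv_mul_cancel₀ (Real.exp_pos 1).ne'
  have he2 : 2 < Real.exp 1 := Real.exp_one_gt_two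
  have he3 : Real.exp 1 < 3 := Real.exp_one_lt_three
  have hd := hasDerivAt_exp_mul_quadratic c
  have hcont : Continuous fun y => Real.exp y * (1 - y + c * y ^ 2) := by fun_prop
  have hfac (y : ℝ) : 2 * c - 1 + c * y = c * (y - (Real.exp 1 - 2)) := by
    linear_combination hce
  rcases le_total x (Real.exp 1 - 2) with h | h
  · have hanti : AntitoneOn (fun y => Real.exp y * (1 - y + c * y ^ 2))
        (Set.Icc 0 (Real.exp 1 - 2)) := by
      refine antitoneOn_of_deriv_nonpos (convex_Icc _ _) hcont.continuousOn
        (fun y _ => (hd y).differentiableAt.differentiableWithinAt) fun y hy => ?_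
      rw [interior_Icc] at hy
      rw [(hd y).deriv, hfac]
      exact mul_nonpos_of_nonneg_of_nonpos (Real.exp_pos y).le
        (mul_nonpos_of_nonneg_of_nonpos hy.1.le
          (mul_nonpos_of_nonneg_of_nonpos hc0.le (sub_nonpos.2 hy.2.le)))
    simpa using hanti ⟨le_rfl, by linarith⟩ ⟨hx0, h⟩ hx0
  · have hmono : MonotoneOn (fun y => Real.exp y * (1 - y + c * y ^ 2))
        (Set.Icc (Real.exp 1 - 2) 1) := by
      refine monotoneOn_of_deriv_nonneg (convex_Icc _ _) hcont.continuousOn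
        (fun y _ => (hd y).differentiableAt.differentiableWithinAt) fun y hy => ?_
      rw [interior_Icc] at hy
      rw [(hd y).deriv, hfac]
      have hy0 : 0 ≤ y := by linarith [hy.1]
      have := sub_nonneg.2 hy.1.le
      positivity
    have := hmono ⟨h, hx1⟩ ⟨by linarith, le_rfl⟩ hx1
    simp only at this
    linarith

theorem helper_iii (x : ℝ) (hx0 : 0 < x) (hx1 : x ≤ 1) :
    1 - 1 / x + Real.exp (-x) / x ≥ x / Real.exp 1 := by
  have h : 1 - x + (Real.exp 1)⁻¹ * x ^ 2 ≤ Real.exp (-x) := by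
    rw [Real.exp_neg, ← one_div (Real.exp x), le_div_iff₀' (Real.exp_pos x)]
    exact exp_mul_quadratic_le_one hx0.le hx1
  have hsplit : 1 - 1 / x + Real.exp (-x) / x - x / Real.exp 1
      = (Real.exp (-x) - (1 - x + (Real.exp 1)⁻¹ * x ^ 2)) / x := by
    field_simp
    ring
  exact sub_nonneg.1 (hsplit ▸ div_nonneg (sub_nonneg.2 h) hx0.le)
end
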